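/- For every integer d ≥ 1, every real-valued Schwartz function F on ℝ^{2d}, and all α, β > 0, one has the identity ∑_{i=1}^d ( Θ_{h^i_α, g_β}(F) + Θ_{g_α, h^i_β}(F) ) = π ‖F‖_{L⁴}⁴. -/

import Mathlib

open MeasureTheory

/-- `L¹`-normalized dilate `f_t(x) = t^{-d} f(t^{-1} x)`. -/
noncomputable def dil {d : ℕ} (t : ℝ) (f : (Fin d → ℝ) → ℝ) : (Fin d → ℝ) → ℝ :=
  fun x => (t ^ d)⁻¹ * f (t⁻¹ • x)

/-- The singular integral form `Θ_{ψ,φ}(F)`. -/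
noncomputable def Theta {d : ℕ} (ψ φ : (Fin d → ℝ) → ℝ)
    (F : (Fin d → ℝ) × (Fin d → ℝ) → ℝ) : ℝ :=
  ∫ t in Set.Ioi (0 : ℝ),
    (∫ q : Fin d → ℝ, ∫ p : Fin d → ℝ, ∫ x : Fin d → ℝ, ∫ y : Fin d → ℝ,
      ∫ x' : Fin d → ℝ, ∫ y' : Fin d → ℝ,
        F (x, x') * F (x, y') * F (y, x') * F (y, y') *
          dil t ψ (x - q) * dil t ψ (y - q) * dil t φ (x' - p) * dil t φ (y' - p)) / t

/-- The standard Gaussian `g(x) = e^{-π ‖x‖²}` on `ℝ^d`. -/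
noncomputable def gauss (d : ℕ) : (Fin d → ℝ) → ℝ :=
  fun x => Real.exp (-Real.pi * ∑ i, x i ^ 2)

/-- `h^i = ∂_i g`, the `i`-th partial derivative of the standard Gaussian. -/
noncomputable def gaussDeriv (d : ℕ) (i : Fin d) : (Fin d → ℝ) → ℝ :=
  fun x => fderiv ℝ (gauss d) x (Pi.single i 1)

/-! ### Fubini for iterated integrals -/

section Fubini

variable {X Y X' Y' Q P : Type*} [MeasureSpace X] [MeasureSpace Y] [MeasureSpace X']
  [MeasureSpace Y'] [MeasureSpace Q] [MeasureSpace P]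
  [SFinite (volume : Measure X)] [SFinite (volume : Measure Y)]
  [SFinite (volume : Measure X')] [SFinite (volume : Measure Y')]
  [SFinite (volume : Measure Q)] [SFinite (volume : Measure P)]

theorem integral_prod_prod_eq_iterated {f : (X × Y) × (X' × Y') → ℝ} (hf : Integrable f) :
    ∫ x, ∫ y, ∫ x', ∫ y', f ((x, y), (x', y')) = ∫ w, f w := by
  have hinner : (fun z : X × Y => ∫ w, f (z, w)) =ᵐ[volume]
      fun z => ∫ x', ∫ y', f (z, (x', y')) := by
    filter_upwards [hf.prod_right_ae] with z hz
    exact integral_prod _ hz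
  rw [show ∫ w, f w = ∫ z, ∫ w, f (z, w) from integral_prod f hf, integral_congr_ae hinner]
  exact (integral_prod _ (hf.integral_prod_left.congr hinner)).symm

theorem integral_prod_prod_prod_eq_iterated {f : (Q × P) × ((X × Y) × (X' × Y')) → ℝ}
    (hf : Integrable f) :
    ∫ q, ∫ p, ∫ x, ∫ y, ∫ x', ∫ y', f ((q, p), ((x, y), (x', y'))) = ∫ w, f w := by
  have hinner : (fun z : Q × P => ∫ w, f (z, w)) =ᵐ[volume]
      fun z => ∫ x, ∫ y, ∫ x', ∫ y', f (z, ((x, y), (x', y'))) := by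
    filter_upwards [hf.prod_right_ae] with z hz
    exact (integral_prod_prod_eq_iterated hz).symm
  rw [show ∫ w, f w = ∫ z, ∫ w, f (z, w) from integral_prod f hf, integral_congr_ae hinner]
  exact (integral_prod _ (hf.integral_prod_left.congr hinner)).symm

/-- Exchanging the two middle factors of a product of four spaces preserves the volume. -/
theorem measurePreserving_prodProdProdComm :
    MeasurePreserving (fun w : (X × Y) × (X' × Y') => ((w.1.1, w.2.1), (w.1.2, w.2.2))) := by
  have h₁ : MeasurePreserving (MeasurableEquiv.prodAssoc : (X × Y) × (X' × Y') ≃ᵐ _) :=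
    measurePreserving_prodAssoc _ _ _
  have h₂ : MeasurePreserving (MeasurableEquiv.prodAssoc.symm : Y × (X' × Y') ≃ᵐ _) :=
    (measurePreserving_prodAssoc _ _ _).symm _
  have h₃ : MeasurePreserving (Prod.map Prod.swap id : (Y × X') × Y' → (X' × Y) × Y') :=
    Measure.measurePreserving_swap.prod (.id _)
  have h₄ : MeasurePreserving (MeasurableEquiv.prodAssoc : (X' × Y) × Y' ≃ᵐ _) :=
    measurePreserving_prodAssoc _ _ _
  have h₅ : MeasurePreserving (MeasurableEquiv.prodAssoc.symm : X × (X' × (Y × Y')) ≃ᵐ _) :=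
    (measurePreserving_prodAssoc _ _ _).symm _
  exact h₅.comp (((MeasurePreserving.id volume).prod (h₄.comp (h₃.comp h₂))).comp h₁)

end Fubini

theorem integrable_mul_comp_sub {Z G : Type*} [MeasureSpace Z] [SFinite (volume : Measure Z)]
    [AddCommGroup G] [MeasurableSpace G] [MeasurableAdd₂ G] [MeasurableNeg G]
    {μ : Measure G} [SFinite μ] [μ.IsAddLeftInvariant] [μ.IsNegInvariant]
    {a : Z → ℝ} {k : G → ℝ} {b : Z → G}
    (ha : Integrable a) (hk : Integrable k μ) (hb : Measurable b) :
    Integrable (fun z : Z × G => a z.1 * k (b z.1 - z.2)) (volume.prod μ) := by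
  have hsub : MeasurePreserving (fun z : Z × G => (id z.1, b z.1 - z.2)) (volume.prod μ)
      (volume.prod μ) :=
    (MeasurePreserving.id volume).skew_product (g := fun z q => b z - q)
      (by simp only [Function.uncurry_def, sub_eq_add_neg]; fun_prop)
      (ae_of_all _ fun z => Measure.map_sub_left_eq_self μ (b z))
  exact hsub.integrable_comp_of_integrable (ha.mul_prod hk)

/-! ### The form `Θ` through autocorrelations -/

/-- The autocorrelation `∫ ψ(x - q) ψ(y - q) dq`. -/
noncomputable def autocorr {d : ℕ} (ψ : (Fin d → ℝ) → ℝ) (x y : Fin d → ℝ) : ℝ :=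
  ∫ q, ψ (x - q) * ψ (y - q)

/-- The product `F(x, x') F(x, y') F(y, x') F(y, y')` at the point `((x, y), (x', y'))`. -/
def quadProd {d : ℕ} (F : (Fin d → ℝ) × (Fin d → ℝ) → ℝ)
    (w : ((Fin d → ℝ) × (Fin d → ℝ)) × ((Fin d → ℝ) × (Fin d → ℝ))) : ℝ :=
  F (w.1.1, w.2.1) * F (w.1.1, w.2.2) * F (w.1.2, w.2.1) * F (w.1.2, w.2.2)

/-- Continuous, bounded and integrable functions. -/
structure IsTame {X : Type*} [TopologicalSpace X] [MeasureSpace X] (f : X → ℝ) : Prop where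
  continuous : Continuous f
  bounded : ∃ C, ∀ x, |f x| ≤ C
  integrable : Integrable f

section Form

variable {d : ℕ} {F : (Fin d → ℝ) × (Fin d → ℝ) → ℝ} {ψ φ : (Fin d → ℝ) → ℝ}

theorem IsTame.continuous_quadProd (hF : IsTame F) : Continuous (quadProd F) := by
  have := hF.continuous
  unfold quadProd
  fun_prop

theorem IsTame.integrable_quadProd (hF : IsTame F) : Integrable (quadProd F) := by
  obtain ⟨C, hC⟩ := hF.bounded
  have h := measurePreserving_prodProdProdComm.integrable_comp_of_integrable
    ((hF.integrable.abs.mul_prod hF.integrable.abs).const_mul (C * C))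
  refine h.mono' hF.continuous_quadProd.aestronglyMeasurable (ae_of_all _ fun w => ?_)
  have hle : |F (w.1.1, w.2.2)| * |F (w.1.2, w.2.1)| ≤ C * C :=
    mul_le_mul (hC _) (hC _) (abs_nonneg _) ((abs_nonneg _).trans (hC 0))
  have := mul_le_mul_of_nonneg_right hle
    (mul_nonneg (abs_nonneg (F (w.1.1, w.2.1))) (abs_nonneg (F (w.1.2, w.2.2))))
  simp only [quadProd, Real.norm_eq_abs, abs_mul, Function.comp_apply] at this ⊢
  linarith

theorem IsTame.integrable_form (hF : IsTame F) (hψ : IsTame ψ) (hφ : IsTame φ) :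
    Integrable fun z : (((Fin d → ℝ) × (Fin d → ℝ)) × ((Fin d → ℝ) × (Fin d → ℝ))) ×
        ((Fin d → ℝ) × (Fin d → ℝ)) =>
      quadProd F z.1 * ((ψ (z.1.1.1 - z.2.1) * ψ (z.1.1.2 - z.2.1)) *
        (φ (z.1.2.1 - z.2.2) * φ (z.1.2.2 - z.2.2))) := by
  obtain ⟨A, hA⟩ := hψ.bounded
  obtain ⟨B, hB⟩ := hφ.bounded
  have : (volume.prod volume : Measure ((Fin d → ℝ) × (Fin d → ℝ))).IsNegInvariant :=
    ⟨((Measure.measurePreserving_neg volume).prod (Measure.measurePreserving_neg volume)).map_eq⟩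
  have h := (integrable_mul_comp_sub (b := fun w : ((Fin d → ℝ) × (Fin d → ℝ)) ×
    ((Fin d → ℝ) × (Fin d → ℝ)) => (w.1.1, w.2.1)) hF.integrable_quadProd.abs
    (hψ.integrable.abs.mul_prod hφ.integrable.abs) (by fun_prop)).const_mul (A * B)
  refine h.mono' ?_ (ae_of_all _ fun z => ?_)
  · have := hF.continuous_quadProd
    have := hψ.continuous
    have := hφ.continuous
    exact Continuous.aestronglyMeasurable (by fun_prop)
  · have hle : |ψ (z.1.1.2 - z.2.1)| * |φ (z.1.2.2 - z.2.2)| ≤ A * B :=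
      mul_le_mul (hA _) (hB _) (abs_nonneg _) ((abs_nonneg _).trans (hA 0))
    have := mul_le_mul_of_nonneg_right hle (mul_nonneg (abs_nonneg (quadProd F z.1))
      (mul_nonneg (abs_nonneg (ψ (z.1.1.1 - z.2.1))) (abs_nonneg (φ (z.1.2.1 - z.2.2)))))
    simp only [Real.norm_eq_abs, abs_mul, Prod.fst_sub, Prod.snd_sub] at this ⊢
    linarith

theorem integral_form_section (ψ φ : (Fin d → ℝ) → ℝ) (c : ℝ) (x y x' y' : Fin d → ℝ) :
    ∫ r : (Fin d → ℝ) × (Fin d → ℝ), c * ((ψ (x - r.1) * ψ (y - r.1)) *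
        (φ (x' - r.2) * φ (y' - r.2))) = c * (autocorr ψ x y * autocorr φ x' y') := by
  rw [integral_const_mul]
  congr 1
  exact integral_prod_mul (fun q => ψ (x - q) * ψ (y - q)) fun p => φ (x' - p) * φ (y' - p)

theorem IsTame.integrable_quadProd_mul_autocorr (hF : IsTame F) (hψ : IsTame ψ)
    (hφ : IsTame φ) : Integrable fun w =>
      quadProd F w * (autocorr ψ w.1.1 w.1.2 * autocorr φ w.2.1 w.2.2) :=
  (hF.integrable_form hψ hφ).integral_prod_left.congr
    (ae_of_all _ fun w => integral_form_section ψ φ (quadProd F w) w.1.1 w.1.2 w.2.1 w.2.2)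

theorem IsTame.iterated_form_eq (hF : IsTame F) (hψ : IsTame ψ) (hφ : IsTame φ) :
    (∫ q : Fin d → ℝ, ∫ p : Fin d → ℝ, ∫ x : Fin d → ℝ, ∫ y : Fin d → ℝ,
      ∫ x' : Fin d → ℝ, ∫ y' : Fin d → ℝ,
        F (x, x') * F (x, y') * F (y, x') * F (y, y') *
          ψ (x - q) * ψ (y - q) * φ (x' - p) * φ (y' - p)) =
    ∫ w, quadProd F w * (autocorr ψ w.1.1 w.1.2 * autocorr φ w.2.1 w.2.2) := by
  have hf := hF.integrable_form hψ hφ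
  have h := integral_prod_prod_prod_eq_iterated hf.swap
  simp only [← integral_form_section ψ φ (quadProd F _)]
  rw [Measure.volume_eq_prod, integral_prod_symm _ hf.swap] at h
  simp only [Function.comp_apply, Prod.swap_prod_mk] at h
  rw [← h]
  simp only [quadProd, mul_assoc]

theorem integral_mul_mul_autocorr_nonneg (hψ : IsTame ψ) {u : (Fin d → ℝ) → ℝ}
    (hu : Integrable u) :
    0 ≤ ∫ w : (Fin d → ℝ) × (Fin d → ℝ), u w.1 * u w.2 * autocorr ψ w.1 w.2 := by
  obtain ⟨A, hA⟩ := hψ.bounded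
  have hint : Integrable fun z : ((Fin d → ℝ) × (Fin d → ℝ)) × (Fin d → ℝ) =>
      u z.1.1 * u z.1.2 * (ψ (z.1.1 - z.2) * ψ (z.1.2 - z.2)) := by
    have h := integrable_mul_comp_sub (b := fun w : (Fin d → ℝ) × (Fin d → ℝ) => w.1)
      (hu.mul_prod hu) hψ.integrable measurable_fst
    have hc := hψ.continuous
    refine (h.mul_bdd (c := A) (g := fun z => ψ (z.1.2 - z.2))
      (Continuous.aestronglyMeasurable (by fun_prop))
      (ae_of_all _ fun z => hA _)).congr (ae_of_all _ fun z => ?_)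
    simp only [mul_assoc]
  calc (0 : ℝ) ≤ ∫ q, (∫ x, u x * ψ (x - q)) * ∫ y, u y * ψ (y - q) :=
        integral_nonneg fun q => mul_self_nonneg _
    _ = ∫ q, ∫ w : (Fin d → ℝ) × (Fin d → ℝ),
          u w.1 * u w.2 * (ψ (w.1 - q) * ψ (w.2 - q)) := by
        congr 1 with q
        refine (integral_prod_mul (fun x => u x * ψ (x - q)) fun y => u y * ψ (y - q)).symm.trans ?_
        exact integral_congr_ae (ae_of_all _ fun w => by ring)
    _ = ∫ w : (Fin d → ℝ) × (Fin d → ℝ), ∫ q, u w.1 * u w.2 * (ψ (w.1 - q) * ψ (w.2 - q)) :=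
        (integral_integral_swap hint).symm
    _ = _ := by simp only [integral_const_mul, autocorr]

theorem IsTame.integral_quadProd_mul_autocorr_nonneg_left (hF : IsTame F) (hψ : IsTame ψ)
    (hφ : IsTame φ) (hpos : ∀ x y, 0 ≤ autocorr φ x y) :
    0 ≤ ∫ w, quadProd F w * (autocorr ψ w.1.1 w.1.2 * autocorr φ w.2.1 w.2.2) := by
  obtain ⟨C, hC⟩ := hF.bounded
  rw [Measure.volume_eq_prod, integral_prod_symm _ (hF.integrable_quadProd_mul_autocorr hψ hφ)]
  refine integral_nonneg_of_ae ?_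
  filter_upwards [Measure.quasiMeasurePreserving_fst.ae hF.integrable.prod_left_ae] with w hw
  have hc := hF.continuous
  have hu : Integrable fun x => F (x, w.1) * F (x, w.2) :=
    hw.mul_bdd (c := C) (Continuous.aestronglyMeasurable (by fun_prop))
      (ae_of_all _ fun z => hC _)
  have h := mul_nonneg (integral_mul_mul_autocorr_nonneg hψ hu) (hpos w.1 w.2)
  rw [← integral_mul_const] at h
  refine h.trans_eq (integral_congr_ae (ae_of_all _ fun z => ?_))
  simp only [quadProd]
  ring

theorem IsTame.comp_swap (hF : IsTame F) : IsTame (F ∘ Prod.swap) where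
  continuous := hF.continuous.comp continuous_swap
  bounded := hF.bounded.imp fun _ hC z => hC z.swap
  integrable := hF.integrable.swap

theorem IsTame.integral_quadProd_mul_autocorr_nonneg_right (hF : IsTame F) (hψ : IsTame ψ)
    (hφ : IsTame φ) (hpos : ∀ x y, 0 ≤ autocorr ψ x y) :
    0 ≤ ∫ w, quadProd F w * (autocorr ψ w.1.1 w.1.2 * autocorr φ w.2.1 w.2.2) := by
  have h := hF.comp_swap.integral_quadProd_mul_autocorr_nonneg_left hφ hψ hpos
  rw [Measure.volume_eq_prod, ← (Measure.measurePreserving_swap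
    (μ := (volume : Measure ((Fin d → ℝ) × (Fin d → ℝ))))
    (ν := (volume : Measure ((Fin d → ℝ) × (Fin d → ℝ))))).integral_comp
    MeasurableEquiv.prodComm.measurableEmbedding] at h
  refine h.trans_eq (integral_congr_ae (ae_of_all _ fun w => ?_))
  simp only [quadProd, Function.comp_apply, Prod.fst_swap, Prod.snd_swap, Prod.swap_prod_mk]
  ring

end Form

/-! ### Autocorrelations of Gaussians -/

/-- The autocorrelation kernel of the dilated Gaussian `g_s`. -/
noncomputable def gaussCorr {d : ℕ} (s : ℝ) (v : Fin d → ℝ) : ℝ :=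
  (√2 ^ d * s ^ d)⁻¹ * Real.exp (-(Real.pi / 2) * ((∑ i, v i ^ 2) / s ^ 2))

/-- The autocorrelation kernel of the dilated partial derivative `h^i_s`. -/
noncomputable def gaussDerivCorr {d : ℕ} (i : Fin d) (s : ℝ) (v : Fin d → ℝ) : ℝ :=
  (Real.pi - Real.pi ^ 2 * (v i ^ 2 / s ^ 2)) * gaussCorr s v

theorem integrable_sq_mul_exp_neg_mul_sq {b : ℝ} (hb : 0 < b) :
    Integrable fun u : ℝ => u ^ 2 * Real.exp (-b * u ^ 2) := by
  simpa using integrable_rpow_mul_exp_neg_mul_sq hb (s := 2) (by norm_num)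

theorem integral_sq_mul_exp_neg_mul_sq {b : ℝ} (hb : 0 < b) :
    ∫ u : ℝ, u ^ 2 * Real.exp (-b * u ^ 2) = √(Real.pi / b) / (2 * b) := by
  have hderiv (u : ℝ) : HasDerivAt (fun u : ℝ => u * Real.exp (-b * u ^ 2))
      (Real.exp (-b * u ^ 2) - 2 * b * (u ^ 2 * Real.exp (-b * u ^ 2))) u := by
    refine ((hasDerivAt_id u).mul (((hasDerivAt_pow 2 u).const_mul (-b)).exp)).congr_deriv ?_
    simp only [id, Nat.cast_ofNat]
    ring
  have hg := integrable_exp_neg_mul_sq hb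
  have hsq := (integrable_sq_mul_exp_neg_mul_sq hb).const_mul (2 * b)
  have h := integral_eq_zero_of_hasDerivAt_of_integrable hderiv (hg.sub hsq)
    (integrable_mul_exp_neg_mul_sq hb)
  rw [integral_sub hg hsq, integral_const_mul, integral_gaussian] at h
  rw [eq_div_iff (by positivity)]
  linarith

theorem sqrt_pi_div_two_pi : √(Real.pi / (2 * Real.pi)) = (√2)⁻¹ := by
  rw [← Real.sqrt_inv]
  congr 1
  field_simp

theorem gaussian_mul_gaussian_sub (a b q : ℝ) :
    Real.exp (-Real.pi * (a - q) ^ 2) * Real.exp (-Real.pi * (b - q) ^ 2) =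
      Real.exp (-(Real.pi / 2) * (a - b) ^ 2) *
        Real.exp (-(2 * Real.pi) * (q - (a + b) / 2) ^ 2) := by
  rw [← Real.exp_add, ← Real.exp_add]
  congr 1
  ring

theorem integral_gaussian_mul_gaussian (a b : ℝ) :
    ∫ q : ℝ, Real.exp (-Real.pi * (a - q) ^ 2) * Real.exp (-Real.pi * (b - q) ^ 2) =
      (√2)⁻¹ * Real.exp (-(Real.pi / 2) * (a - b) ^ 2) := by
  simp only [gaussian_mul_gaussian_sub, integral_const_mul]
  rw [integral_sub_right_eq_self (fun u => Real.exp (-(2 * Real.pi) * u ^ 2)),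
    integral_gaussian, sqrt_pi_div_two_pi, mul_comm]

theorem integral_gaussianDeriv_mul_gaussianDeriv (a b : ℝ) :
    ∫ q : ℝ, (-2 * Real.pi * (a - q) * Real.exp (-Real.pi * (a - q) ^ 2)) *
        (-2 * Real.pi * (b - q) * Real.exp (-Real.pi * (b - q) ^ 2)) =
      (Real.pi - Real.pi ^ 2 * (a - b) ^ 2) *
        ((√2)⁻¹ * Real.exp (-(Real.pi / 2) * (a - b) ^ 2)) := by
  have hpi : 0 < 2 * Real.pi := by positivity
  have hsq := (integrable_sq_mul_exp_neg_mul_sq hpi).const_mul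
    (4 * Real.pi ^ 2 * Real.exp (-(Real.pi / 2) * (a - b) ^ 2))
  have hg := (integrable_exp_neg_mul_sq hpi).const_mul
    (Real.pi ^ 2 * (a - b) ^ 2 * Real.exp (-(Real.pi / 2) * (a - b) ^ 2))
  have hcongr (q : ℝ) : (-2 * Real.pi * (a - q) * Real.exp (-Real.pi * (a - q) ^ 2)) *
        (-2 * Real.pi * (b - q) * Real.exp (-Real.pi * (b - q) ^ 2)) =
      (fun u => 4 * Real.pi ^ 2 * Real.exp (-(Real.pi / 2) * (a - b) ^ 2) *
          (u ^ 2 * Real.exp (-(2 * Real.pi) * u ^ 2)) -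
        Real.pi ^ 2 * (a - b) ^ 2 * Real.exp (-(Real.pi / 2) * (a - b) ^ 2) *
          Real.exp (-(2 * Real.pi) * u ^ 2)) (q - (a + b) / 2) := by
    linear_combination (4 * Real.pi ^ 2 * (a - q) * (b - q)) * gaussian_mul_gaussian_sub a b q
  refine ((integral_congr_ae (ae_of_all _ hcongr)).trans
    (integral_sub_right_eq_self (μ := volume)
      (fun u : ℝ => 4 * Real.pi ^ 2 * Real.exp (-(Real.pi / 2) * (a - b) ^ 2) *
          (u ^ 2 * Real.exp (-(2 * Real.pi) * u ^ 2)) -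
        Real.pi ^ 2 * (a - b) ^ 2 * Real.exp (-(Real.pi / 2) * (a - b) ^ 2) *
          Real.exp (-(2 * Real.pi) * u ^ 2)) ((a + b) / 2))).trans ?_
  rw [integral_sub hsq hg, integral_const_mul, integral_const_mul,
    integral_sq_mul_exp_neg_mul_sq hpi, integral_gaussian, sqrt_pi_div_two_pi]
  field_simp
  ring

section Gauss

variable {d : ℕ}

theorem IsTame.prod {f : Fin d → ℝ → ℝ} (hf : ∀ j, IsTame (f j)) :
    IsTame fun x : Fin d → ℝ => ∏ j, f j (x j) where
  continuous := continuous_finsetProd _ fun j _ => (hf j).continuous.comp (continuous_apply j)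
  bounded := by
    choose C hC using fun j => (hf j).bounded
    exact ⟨∏ j, C j, fun x => (Finset.abs_prod _ _).trans_le
      (Finset.prod_le_prod (fun _ _ => abs_nonneg _) fun j _ => hC j _)⟩
  integrable := Integrable.fintype_prod fun j => (hf j).integrable

theorem autocorr_prod (f : Fin d → ℝ → ℝ) (x y : Fin d → ℝ) :
    autocorr (fun x => ∏ j, f j (x j)) x y = ∏ j, ∫ q, f j (x j - q) * f j (y j - q) := by
  simp only [autocorr, ← Finset.prod_mul_distrib, Pi.sub_apply]
  exact integral_fintype_prod_volume_eq_prod fun j q => f j (x j - q) * f j (y j - q)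

theorem IsTame.dil {ψ : (Fin d → ℝ) → ℝ} (hψ : IsTame ψ) {s : ℝ} (hs : 0 < s) :
    IsTame (dil s ψ) where
  continuous := by
    have := hψ.continuous
    unfold _root_.dil
    fun_prop
  bounded := by
    obtain ⟨C, hC⟩ := hψ.bounded
    refine ⟨(s ^ d)⁻¹ * C, fun x => ?_⟩
    rw [_root_.dil, abs_mul, abs_of_pos (by positivity)]
    exact mul_le_mul_of_nonneg_left (hC _) (by positivity)
  integrable := (hψ.integrable.comp_smul (inv_ne_zero hs.ne')).const_mul _

theorem dil_dil (f : (Fin d → ℝ) → ℝ) (s t : ℝ) : dil t (dil s f) = dil (s * t) f := by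
  ext x
  simp only [dil, smul_smul, mul_pow, mul_inv]
  ring

theorem autocorr_dil (ψ : (Fin d → ℝ) → ℝ) {s : ℝ} (hs : 0 < s) (x y : Fin d → ℝ) :
    autocorr (dil s ψ) x y = (s ^ d)⁻¹ * autocorr ψ (s⁻¹ • x) (s⁻¹ • y) := by
  have h := Measure.integral_comp_inv_smul_of_nonneg (volume : Measure (Fin d → ℝ))
    (fun q => ψ (s⁻¹ • x - q) * ψ (s⁻¹ • y - q)) hs.le
  rw [Module.finrank_fin_fun, smul_eq_mul] at h
  calc autocorr (dil s ψ) x y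
      = (s ^ d)⁻¹ * (s ^ d)⁻¹ * ∫ q, ψ (s⁻¹ • x - s⁻¹ • q) * ψ (s⁻¹ • y - s⁻¹ • q) := by
        rw [← integral_const_mul, autocorr]
        congr 1 with q
        simp only [dil, smul_sub]
        ring
    _ = _ := by
        rw [h, autocorr]
        field_simp

theorem gauss_eq_prod : gauss d = fun x => ∏ j, Real.exp (-Real.pi * x j ^ 2) := by
  ext x
  rw [gauss, Finset.mul_sum, Real.exp_sum]

theorem gaussDeriv_apply (i : Fin d) (x : Fin d → ℝ) :
    gaussDeriv d i x = -2 * Real.pi * x i * gauss d x := by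
  have h : HasFDerivAt (gauss d) (gauss d x • (-Real.pi) • ∑ j : Fin d,
      (2 * x j ^ 1) • ContinuousLinearMap.proj (R := ℝ) (φ := fun _ : Fin d => ℝ) j) x := by
    refine HasFDerivAt.exp (HasFDerivAt.const_mul (HasFDerivAt.fun_sum fun j _ => ?_) _)
    have hj : HasFDerivAt (fun f : Fin d → ℝ => f j)
        (ContinuousLinearMap.proj (R := ℝ) (φ := fun _ : Fin d => ℝ) j) x := hasFDerivAt_apply j x
    simpa using hj.pow 2
  rw [gaussDeriv, h.fderiv]
  simp [Pi.single_apply]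
  ring

theorem gaussDeriv_eq_prod (i : Fin d) : gaussDeriv d i =
    fun x => ∏ j, (if j = i then fun a => -2 * Real.pi * a * Real.exp (-Real.pi * a ^ 2)
      else fun a => Real.exp (-Real.pi * a ^ 2)) (x j) := by
  ext x
  have hfactor (j : Fin d) : (if j = i then fun a => -2 * Real.pi * a *
      Real.exp (-Real.pi * a ^ 2) else fun a => Real.exp (-Real.pi * a ^ 2)) (x j) =
      (if j = i then -2 * Real.pi * x j else 1) * Real.exp (-Real.pi * x j ^ 2) := by
    split_ifs <;> simp
  simp only [gaussDeriv_apply, gauss_eq_prod, hfactor, Finset.prod_mul_distrib,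
    Finset.prod_ite_eq', Finset.mem_univ, if_true]

theorem isTame_gaussian : IsTame fun a : ℝ => Real.exp (-Real.pi * a ^ 2) where
  continuous := by fun_prop
  bounded := ⟨1, fun a => by
    rw [Real.abs_exp, Real.exp_le_one_iff]
    nlinarith [Real.pi_pos, sq_nonneg a]⟩
  integrable := integrable_exp_neg_mul_sq Real.pi_pos

theorem isTame_gaussianDeriv :
    IsTame fun a : ℝ => -2 * Real.pi * a * Real.exp (-Real.pi * a ^ 2) where
  continuous := by fun_prop
  bounded := by
    refine ⟨2 * Real.pi, fun a => ?_⟩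
    have hle : |a| ≤ Real.exp (Real.pi * a ^ 2) := by
      refine le_trans ?_ (Real.add_one_le_exp _)
      nlinarith [Real.pi_gt_three, sq_abs a, sq_nonneg (|a| - 1), sq_nonneg a]
    rw [abs_mul, abs_mul, Real.abs_exp, neg_mul Real.pi, Real.exp_neg, abs_mul,
      abs_of_pos Real.pi_pos]
    norm_num
    rw [mul_assoc, ← div_eq_mul_inv]
    exact mul_le_of_le_one_right (by positivity) ((div_le_one (Real.exp_pos _)).2 hle)
  integrable := by
    simpa only [mul_assoc] using
      (integrable_mul_exp_neg_mul_sq Real.pi_pos).const_mul (-2 * Real.pi)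

theorem isTame_gauss : IsTame (gauss d) :=
  gauss_eq_prod ▸ IsTame.prod fun _ => isTame_gaussian

theorem isTame_gaussDeriv (i : Fin d) : IsTame (gaussDeriv d i) := by
  rw [gaussDeriv_eq_prod]
  refine IsTame.prod fun j => ?_
  split_ifs
  exacts [isTame_gaussianDeriv, isTame_gaussian]

theorem gaussCorr_one (v : Fin d → ℝ) :
    gaussCorr 1 v = ∏ j, (√2)⁻¹ * Real.exp (-(Real.pi / 2) * v j ^ 2) := by
  simp [gaussCorr, Finset.prod_mul_distrib, ← Real.exp_sum, Finset.mul_sum]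

theorem inv_pow_mul_gaussCorr_one (s : ℝ) (v : Fin d → ℝ) :
    (s ^ d)⁻¹ * gaussCorr 1 (s⁻¹ • v) = gaussCorr s v := by
  simp only [gaussCorr, Pi.smul_apply, smul_eq_mul, mul_pow, ← Finset.mul_sum]
  simp only [one_pow, mul_one, mul_inv, inv_pow, div_eq_inv_mul]
  ring_nf

theorem autocorr_gauss (x y : Fin d → ℝ) : autocorr (gauss d) x y = gaussCorr 1 (x - y) := by
  simp only [gauss_eq_prod, autocorr_prod (fun _ a => Real.exp (-Real.pi * a ^ 2)),
    integral_gaussian_mul_gaussian, gaussCorr_one, Pi.sub_apply]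

theorem autocorr_gaussDeriv (i : Fin d) (x y : Fin d → ℝ) :
    autocorr (gaussDeriv d i) x y = gaussDerivCorr i 1 (x - y) := by
  have hfactor (j : Fin d) : (∫ q, (if j = i then fun a => -2 * Real.pi * a *
      Real.exp (-Real.pi * a ^ 2) else fun a => Real.exp (-Real.pi * a ^ 2)) (x j - q) *
      (if j = i then fun a => -2 * Real.pi * a *
      Real.exp (-Real.pi * a ^ 2) else fun a => Real.exp (-Real.pi * a ^ 2)) (y j - q)) =
      (if j = i then Real.pi - Real.pi ^ 2 * (x j - y j) ^ 2 else 1) *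
        ((√2)⁻¹ * Real.exp (-(Real.pi / 2) * (x j - y j) ^ 2)) := by
    split_ifs
    · exact integral_gaussianDeriv_mul_gaussianDeriv _ _
    · rw [one_mul]
      exact integral_gaussian_mul_gaussian _ _
  rw [gaussDeriv_eq_prod, autocorr_prod]
  simp only [hfactor, Finset.prod_mul_distrib (f := fun j => ite (j = i) _ _),
    Finset.prod_ite_eq', Finset.mem_univ, if_true, gaussDerivCorr, gaussCorr_one, Pi.sub_apply,
    one_pow, div_one]

theorem autocorr_dil_gauss {s : ℝ} (hs : 0 < s) (x y : Fin d → ℝ) :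
    autocorr (dil s (gauss d)) x y = gaussCorr s (x - y) := by
  rw [autocorr_dil _ hs, autocorr_gauss, ← smul_sub, inv_pow_mul_gaussCorr_one]

theorem autocorr_dil_gaussDeriv (i : Fin d) {s : ℝ} (hs : 0 < s) (x y : Fin d → ℝ) :
    autocorr (dil s (gaussDeriv d i)) x y = gaussDerivCorr i s (x - y) := by
  rw [autocorr_dil _ hs, autocorr_gaussDeriv, ← smul_sub, gaussDerivCorr, gaussDerivCorr,
    ← inv_pow_mul_gaussCorr_one s]
  simp only [Pi.smul_apply, smul_eq_mul, one_pow, div_one, mul_pow, inv_pow]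
  ring

theorem gaussCorr_nonneg {s : ℝ} (hs : 0 < s) (v : Fin d → ℝ) : 0 ≤ gaussCorr s v := by
  unfold gaussCorr
  positivity

theorem sqrt_two_pow_mul_inv_le {s : ℝ} (hs : 0 < s) : (√2 ^ d * s ^ d)⁻¹ ≤ (s ^ d)⁻¹ := by
  refine inv_anti₀ (by positivity) (le_mul_of_one_le_left (by positivity) (one_le_pow₀ ?_))
  rw [Real.one_le_sqrt]
  norm_num

theorem gaussCorr_le {s : ℝ} (hs : 0 < s) (v : Fin d → ℝ) : gaussCorr s v ≤ (s ^ d)⁻¹ := by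
  refine (mul_le_of_le_one_right (by positivity) ?_).trans (sqrt_two_pow_mul_inv_le hs)
  rw [Real.exp_le_one_iff, neg_mul, neg_nonpos]
  positivity

theorem abs_gaussDerivCorr_le (i : Fin d) {s : ℝ} (hs : 0 < s) (v : Fin d → ℝ) :
    |gaussDerivCorr i s v| ≤ 3 * Real.pi * (s ^ d)⁻¹ := by
  set r := (∑ j, v j ^ 2) / s ^ 2 with hr
  have hvr : v i ^ 2 / s ^ 2 ≤ r := by
    rw [hr]
    gcongr
    exact Finset.single_le_sum (f := fun j => v j ^ 2) (fun j _ => sq_nonneg _) (Finset.mem_univ i)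
  have hv0 : 0 ≤ v i ^ 2 / s ^ 2 := by positivity
  have hpi := Real.pi_pos
  have hfac : |Real.pi - Real.pi ^ 2 * (v i ^ 2 / s ^ 2)| ≤
      3 * Real.pi * Real.exp (Real.pi / 2 * r) := by
    have hexp := Real.add_one_le_exp (Real.pi / 2 * r)
    have h₁ : Real.pi ^ 2 * (v i ^ 2 / s ^ 2) ≤ Real.pi ^ 2 * r := by gcongr
    have h₂ : 3 * Real.pi * (Real.pi / 2 * r + 1) ≤ 3 * Real.pi * Real.exp (Real.pi / 2 * r) := by
      gcongr
    have h₃ : 0 ≤ Real.pi ^ 2 * (v i ^ 2 / s ^ 2) := by positivity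
    rw [abs_le]
    constructor <;> nlinarith
  have hcancel : Real.exp (Real.pi / 2 * r) * Real.exp (-(Real.pi / 2) * r) = 1 := by
    rw [← Real.exp_add]
    simp
  calc |gaussDerivCorr i s v|
      = |Real.pi - Real.pi ^ 2 * (v i ^ 2 / s ^ 2)| *
          ((√2 ^ d * s ^ d)⁻¹ * Real.exp (-(Real.pi / 2) * r)) := by
        rw [gaussDerivCorr, abs_mul, abs_of_nonneg (gaussCorr_nonneg hs v), gaussCorr]
    _ ≤ 3 * Real.pi * Real.exp (Real.pi / 2 * r) *
          ((s ^ d)⁻¹ * Real.exp (-(Real.pi / 2) * r)) := by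
        have := sqrt_two_pow_mul_inv_le (d := d) hs
        exact mul_le_mul hfac (mul_le_mul_of_nonneg_right this (Real.exp_nonneg _))
          (by positivity) (by positivity)
    _ = 3 * Real.pi * (s ^ d)⁻¹ := by
        linear_combination (3 * Real.pi * (s ^ d)⁻¹) * hcancel

theorem hasDerivAt_gaussCorr {s : ℝ} (hs : 0 < s) (v : Fin d → ℝ) :
    HasDerivAt (fun s => gaussCorr s v) (-(Real.pi * s)⁻¹ * ∑ i, gaussDerivCorr i s v) s := by
  have hpow : HasDerivAt (fun s : ℝ => √2 ^ d * s ^ d) (√2 ^ d * (d * s ^ (d - 1))) s :=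
    (hasDerivAt_pow d s).const_mul _
  have hquot : HasDerivAt (fun s : ℝ => -(Real.pi / 2) * ((∑ i, v i ^ 2) / s ^ 2))
      (Real.pi * (∑ i, v i ^ 2) / s ^ 3) s := by
    refine (((hasDerivAt_const s (∑ i, v i ^ 2)).div (hasDerivAt_pow 2 s)
      (by positivity)).const_mul (-(Real.pi / 2))).congr_deriv ?_
    field_simp
    ring
  refine ((hpow.fun_inv (by positivity)).mul hquot.exp).congr_deriv ?_
  have hsum : ∑ i, gaussDerivCorr i s v =
      (Real.pi * d - Real.pi ^ 2 * ((∑ i, v i ^ 2) / s ^ 2)) * gaussCorr s v := by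
    simp only [gaussDerivCorr, ← Finset.sum_mul, Finset.sum_sub_distrib, ← Finset.mul_sum,
      ← Finset.sum_div]
    simp [mul_comm]
  have hds : (d : ℝ) * s ^ (d - 1) = d * s ^ d / s := by
    rcases d with _ | d
    · simp
    · rw [Nat.add_sub_cancel, pow_succ]
      field_simp
  rw [hsum, hds, gaussCorr]
  have := Real.pi_pos
  field_simp
  ring

theorem continuous_gaussCorr (s : ℝ) : Continuous (gaussCorr (d := d) s) := by
  unfold gaussCorr
  fun_prop

theorem continuous_gaussDerivCorr (i : Fin d) (s : ℝ) :
    Continuous (gaussDerivCorr i s) := by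
  have := continuous_gaussCorr (d := d) s
  unfold gaussDerivCorr
  fun_prop

theorem measurable_gaussCorr : Measurable fun z : ℝ × (Fin d → ℝ) => gaussCorr z.1 z.2 := by
  unfold gaussCorr
  fun_prop

theorem measurable_gaussDerivCorr (i : Fin d) :
    Measurable fun z : ℝ × (Fin d → ℝ) => gaussDerivCorr i z.1 z.2 := by
  have := measurable_gaussCorr (d := d)
  unfold gaussDerivCorr
  fun_prop

theorem integrable_gaussCorr_one : Integrable (gaussCorr (d := d) 1) := by
  simp only [funext gaussCorr_one]
  exact Integrable.fintype_prod fun j =>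
    (integrable_exp_neg_mul_sq (by positivity : 0 < Real.pi / 2)).const_mul _

theorem integral_gaussCorr_one : ∫ v : Fin d → ℝ, gaussCorr 1 v = 1 := by
  simp only [gaussCorr_one]
  rw [integral_fintype_prod_volume_eq_prod
    (fun _ a => (√2)⁻¹ * Real.exp (-(Real.pi / 2) * a ^ 2))]
  refine Finset.prod_eq_one fun j _ => ?_
  rw [integral_const_mul, integral_gaussian, show Real.pi / (Real.pi / 2) = 2 by field_simp]
  exact inv_mul_cancel₀ (by positivity)

/-- Rescaling a convolution against the kernel at scale `s`. -/
theorem integral_mul_gaussCorr_sub {s : ℝ} (hs : 0 < s) (f : (Fin d → ℝ) → ℝ) (x : Fin d → ℝ) :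
    ∫ y, f y * gaussCorr s (x - y) = ∫ u, f (x - s • u) * gaussCorr 1 u := by
  have h := Measure.integral_comp_inv_smul_of_nonneg (volume : Measure (Fin d → ℝ))
    (fun u => f (x - s • u) * gaussCorr 1 u) hs.le
  rw [Module.finrank_fin_fun, smul_eq_mul] at h
  simp only [smul_inv_smul₀ hs.ne'] at h
  rw [← integral_sub_left_eq_self _ volume x]
  simp only [sub_sub_cancel, ← inv_pow_mul_gaussCorr_one s, mul_left_comm (f _),
    integral_const_mul, h]
  field_simp

end Gauss

/-! ### The monotone quantity and its limits -/

/-- The form `∫ F(x, x') F(x, y') F(y, x') F(y, y') k(x - y) l(x' - y')`. -/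
noncomputable def corrForm {d : ℕ} (F : (Fin d → ℝ) × (Fin d → ℝ) → ℝ)
    (k l : (Fin d → ℝ) → ℝ) : ℝ :=
  ∫ w, quadProd F w * (k (w.1.1 - w.1.2) * l (w.2.1 - w.2.2))

section Flow

open Filter Topology Set

variable {d : ℕ} {F : (Fin d → ℝ) × (Fin d → ℝ) → ℝ}

theorem IsTame.integrable_quadProd_mul (hF : IsTame F) {k l : (Fin d → ℝ) → ℝ}
    (hk : Continuous k) (hl : Continuous l) {A B : ℝ} (hA : ∀ v, |k v| ≤ A)
    (hB : ∀ v, |l v| ≤ B) :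
    Integrable fun w => quadProd F w * (k (w.1.1 - w.1.2) * l (w.2.1 - w.2.2)) := by
  refine hF.integrable_quadProd.mul_bdd (c := A * B)
    (Continuous.aestronglyMeasurable (by fun_prop)) (ae_of_all _ fun w => ?_)
  rw [Real.norm_eq_abs, abs_mul]
  exact mul_le_mul (hA _) (hB _) (abs_nonneg _) ((abs_nonneg _).trans (hA 0))

theorem abs_gaussCorr_le {s : ℝ} (hs : 0 < s) (v : Fin d → ℝ) : |gaussCorr s v| ≤ (s ^ d)⁻¹ :=
  (abs_of_nonneg (gaussCorr_nonneg hs v)).trans_le (gaussCorr_le hs v)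

theorem hasDerivAt_gaussCorr_mul {α t : ℝ} (hα : 0 < α) (ht : 0 < t) (v : Fin d → ℝ) :
    HasDerivAt (fun t => gaussCorr (α * t) v)
      (-(Real.pi * t)⁻¹ * ∑ i, gaussDerivCorr i (α * t) v) t := by
  have h := (hasDerivAt_gaussCorr (mul_pos hα ht) v).comp t ((hasDerivAt_id t).const_mul α)
  refine h.congr_deriv ?_
  field_simp

theorem abs_deriv_kernel_le {α β t c : ℝ} (hα : 0 < α) (hβ : 0 < β) (hc : 0 < c) (ht : c ≤ t)
    (v v' : Fin d → ℝ) :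
    |-(Real.pi * t)⁻¹ * ∑ i, (gaussDerivCorr i (α * t) v * gaussCorr (β * t) v' +
        gaussCorr (α * t) v * gaussDerivCorr i (β * t) v')| ≤
      (Real.pi * c)⁻¹ * ∑ _i : Fin d, 6 * Real.pi * (((α * c) ^ d)⁻¹ * ((β * c) ^ d)⁻¹) := by
  have ht0 : 0 < t := hc.trans_le ht
  have hαt : ((α * t) ^ d)⁻¹ ≤ ((α * c) ^ d)⁻¹ := by gcongr
  have hβt : ((β * t) ^ d)⁻¹ ≤ ((β * c) ^ d)⁻¹ := by gcongr
  rw [abs_mul, abs_neg, abs_of_pos (by positivity : 0 < (Real.pi * t)⁻¹)]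
  refine mul_le_mul (by gcongr) ((Finset.abs_sum_le_sum_abs _ _).trans
    (Finset.sum_le_sum fun i _ => (abs_add_le _ _).trans ?_)) (abs_nonneg _) (by positivity)
  rw [abs_mul, abs_mul]
  have hpi := Real.pi_pos
  have h₁ := mul_le_mul ((abs_gaussDerivCorr_le i (mul_pos hα ht0) v).trans
    (mul_le_mul_of_nonneg_left hαt (by positivity)))
    ((abs_gaussCorr_le (mul_pos hβ ht0) v').trans hβt) (abs_nonneg _) (by positivity)
  have h₂ := mul_le_mul ((abs_gaussCorr_le (mul_pos hα ht0) v).trans hαt)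
    ((abs_gaussDerivCorr_le i (mul_pos hβ ht0) v').trans
    (mul_le_mul_of_nonneg_left hβt (by positivity))) (abs_nonneg _) (by positivity)
  linarith

theorem IsTame.hasDerivAt_corrForm (hF : IsTame F) {α β t : ℝ} (hα : 0 < α) (hβ : 0 < β)
    (ht : 0 < t) :
    HasDerivAt (fun t => corrForm F (gaussCorr (α * t)) (gaussCorr (β * t)))
      (-(Real.pi * t)⁻¹ * ∑ i, (corrForm F (gaussDerivCorr i (α * t)) (gaussCorr (β * t)) +
        corrForm F (gaussCorr (α * t)) (gaussDerivCorr i (β * t)))) t := by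
  have hαt := mul_pos hα ht
  have hβt := mul_pos hβ ht
  have hg (s : ℝ) := continuous_gaussCorr (d := d) s
  have hh (i : Fin d) (s : ℝ) := continuous_gaussDerivCorr i s
  have hq := hF.continuous_quadProd
  have hmem : Ioi (t / 2) ∈ 𝓝 t := Ioi_mem_nhds (by linarith)
  have key := (hasDerivAt_integral_of_dominated_loc_of_deriv_le (μ := volume) hmem
    (F := fun t w => quadProd F w *
      (gaussCorr (α * t) (w.1.1 - w.1.2) * gaussCorr (β * t) (w.2.1 - w.2.2)))
    (F' := fun t w => quadProd F w * (-(Real.pi * t)⁻¹ * ∑ i,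
      (gaussDerivCorr i (α * t) (w.1.1 - w.1.2) * gaussCorr (β * t) (w.2.1 - w.2.2) +
        gaussCorr (α * t) (w.1.1 - w.1.2) * gaussDerivCorr i (β * t) (w.2.1 - w.2.2))))
    (bound := fun w => |quadProd F w| * ((Real.pi * (t / 2))⁻¹ *
      ∑ _i : Fin d, 6 * Real.pi * (((α * (t / 2)) ^ d)⁻¹ * ((β * (t / 2)) ^ d)⁻¹)))
    (.of_forall fun s => Continuous.aestronglyMeasurable (by fun_prop))
    (hF.integrable_quadProd_mul (hg _) (hg _) (abs_gaussCorr_le hαt) (abs_gaussCorr_le hβt))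
    (Continuous.aestronglyMeasurable (by fun_prop))
    (ae_of_all _ fun w s hs => ?_) (hF.integrable_quadProd.abs.mul_const _)
    (ae_of_all _ fun w s hs => ?_)).2
  · refine key.congr_deriv ?_
    have hint₁ (i : Fin d) := hF.integrable_quadProd_mul (hh i _) (hg _)
      (abs_gaussDerivCorr_le i hαt) (abs_gaussCorr_le hβt)
    have hint₂ (i : Fin d) := hF.integrable_quadProd_mul (hg _) (hh i _)
      (abs_gaussCorr_le hαt) (abs_gaussDerivCorr_le i hβt)
    simp only [mul_left_comm (quadProd F _) (-_), integral_const_mul, corrForm,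
      ← integral_add (hint₁ _) (hint₂ _)]
    rw [← integral_finsetSum _ (f := fun i w => _ + _) fun i _ => (hint₁ i).add (hint₂ i)]
    simp only [← mul_add, ← Finset.mul_sum]
  · rw [Real.norm_eq_abs, abs_mul]
    exact mul_le_mul_of_nonneg_left
      (abs_deriv_kernel_le hα hβ (half_pos ht) (le_of_lt hs) _ _) (abs_nonneg _)
  · have hs0 : 0 < s := (half_pos ht).trans hs
    refine (((hasDerivAt_gaussCorr_mul hα hs0 _).mul
      (hasDerivAt_gaussCorr_mul hβ hs0 _)).const_mul _).congr_deriv ?_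
    simp only [Finset.sum_add_distrib, ← Finset.sum_mul, ← Finset.mul_sum]
    ring

theorem IsTame.tendsto_corrForm_atTop (hF : IsTame F) (hd : 1 ≤ d) {α β : ℝ} (hα : 0 < α)
    (hβ : 0 < β) :
    Tendsto (fun t => corrForm F (gaussCorr (α * t)) (gaussCorr (β * t))) atTop (𝓝 0) := by
  have hpow {a : ℝ} (ha : 0 < a) : Tendsto (fun t : ℝ => ((a * t) ^ d)⁻¹) atTop (𝓝 0) :=
    ((tendsto_pow_atTop (by lia)).comp (tendsto_id.const_mul_atTop ha)).inv_tendsto_atTop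
  have hlim : Tendsto (fun t : ℝ => (∫ w, |quadProd F w|) * (((α * t) ^ d)⁻¹ * ((β * t) ^ d)⁻¹))
      atTop (𝓝 0) := by
    simpa using ((hpow hα).mul (hpow hβ)).const_mul (∫ w, |quadProd F w|)
  refine squeeze_zero_norm' ?_ hlim
  filter_upwards [eventually_gt_atTop 0] with t ht
  rw [← integral_mul_const]
  refine norm_integral_le_of_norm_le (hF.integrable_quadProd.abs.mul_const _)
    (ae_of_all _ fun w => ?_)
  rw [Real.norm_eq_abs, abs_mul, abs_mul]
  gcongr
  exacts [abs_gaussCorr_le (mul_pos hα ht) _, abs_gaussCorr_le (mul_pos hβ ht) _]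

theorem iterated_integral_mul_gaussCorr_sub {a b : ℝ} (ha : 0 < a) (hb : 0 < b)
    (Φ : (Fin d → ℝ) → (Fin d → ℝ) → ℝ) (x x' : Fin d → ℝ) :
    ∫ y, ∫ y', Φ y y' * (gaussCorr a (x - y) * gaussCorr b (x' - y')) =
      ∫ u, ∫ u', Φ (x - a • u) (x' - b • u') * (gaussCorr 1 u * gaussCorr 1 u') := by
  simp only [mul_left_comm (Φ _ _), integral_const_mul, integral_mul_gaussCorr_sub hb]
  simp only [mul_comm (gaussCorr _ _) (integral _ _)]
  exact integral_mul_gaussCorr_sub ha (fun y => ∫ u', Φ y (x' - b • u') * gaussCorr 1 u') x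

/-- The integrand after rescaling: `w.1` is a base point and `w.2` a rescaled displacement. -/
noncomputable def rescaledIntegrand (F : (Fin d → ℝ) × (Fin d → ℝ) → ℝ) (a b : ℝ)
    (w : ((Fin d → ℝ) × (Fin d → ℝ)) × ((Fin d → ℝ) × (Fin d → ℝ))) : ℝ :=
  F w.1 * F (w.1.1, w.1.2 - b • w.2.2) * F (w.1.1 - a • w.2.1, w.1.2) *
    F (w.1.1 - a • w.2.1, w.1.2 - b • w.2.2) * (gaussCorr 1 w.2.1 * gaussCorr 1 w.2.2)

theorem IsTame.continuous_rescaledIntegrand (hF : IsTame F) (a b : ℝ) :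
    Continuous (rescaledIntegrand F a b) := by
  have := hF.continuous
  have := continuous_gaussCorr (d := d) 1
  unfold rescaledIntegrand
  fun_prop

theorem IsTame.exists_bound_rescaledIntegrand (hF : IsTame F) :
    ∃ g : ((Fin d → ℝ) × (Fin d → ℝ)) × ((Fin d → ℝ) × (Fin d → ℝ)) → ℝ,
      Integrable g ∧ ∀ a b w, ‖rescaledIntegrand F a b w‖ ≤ g w := by
  obtain ⟨C, hC⟩ := hF.bounded
  have hC0 : 0 ≤ C := (abs_nonneg _).trans (hC 0)
  refine ⟨fun w => |F w.1| * C * C * C * (gaussCorr 1 w.2.1 * gaussCorr 1 w.2.2), ?_, ?_⟩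
  · exact (((hF.integrable.abs.mul_const C).mul_const C).mul_const C).mul_prod
      (integrable_gaussCorr_one.mul_prod integrable_gaussCorr_one)
  · intro a b w
    have h₁ := gaussCorr_nonneg one_pos w.2.1
    have h₂ := gaussCorr_nonneg one_pos w.2.2
    rw [rescaledIntegrand, Real.norm_eq_abs, abs_mul, abs_mul, abs_mul, abs_mul,
      abs_of_nonneg (mul_nonneg h₁ h₂)]
    exact mul_le_mul_of_nonneg_right (by gcongr <;> exact hC _) (mul_nonneg h₁ h₂)

theorem IsTame.corrForm_eq_integral_rescaledIntegrand (hF : IsTame F) {a b : ℝ} (ha : 0 < a)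
    (hb : 0 < b) :
    corrForm F (gaussCorr a) (gaussCorr b) = ∫ w, rescaledIntegrand F a b w := by
  obtain ⟨g, hg, hle⟩ := hF.exists_bound_rescaledIntegrand
  have hint : Integrable (rescaledIntegrand F a b) :=
    hg.mono' (hF.continuous_rescaledIntegrand a b).aestronglyMeasurable
      (ae_of_all _ fun w => hle a b w)
  have hform := measurePreserving_prodProdProdComm.integrable_comp_of_integrable
    (hF.integrable_quadProd_mul (continuous_gaussCorr a) (continuous_gaussCorr b)
      (abs_gaussCorr_le ha) (abs_gaussCorr_le hb))
  have hcomm := (measurePreserving_prodProdProdComm (X := Fin d → ℝ) (Y := Fin d → ℝ)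
    (X' := Fin d → ℝ) (Y' := Fin d → ℝ)).integral_comp
    (Homeomorph.prodProdProdComm _ _ _ _).measurableEmbedding
    (fun w => quadProd F w * (gaussCorr a (w.1.1 - w.1.2) * gaussCorr b (w.2.1 - w.2.2)))
  refine (hcomm.symm.trans (integral_prod_prod_eq_iterated hform).symm).trans ?_
  rw [← integral_prod_prod_eq_iterated hint]
  congr 1 with x
  congr 1 with x'
  exact iterated_integral_mul_gaussCorr_sub ha hb
    (fun y y' => F (x, x') * F (x, y') * F (y, x') * F (y, y')) x x'

theorem IsTame.tendsto_corrForm_zero (hF : IsTame F) {α β : ℝ} (hα : 0 < α) (hβ : 0 < β) :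
    Tendsto (fun t => corrForm F (gaussCorr (α * t)) (gaussCorr (β * t))) (𝓝[>] 0)
      (𝓝 (∫ z, |F z| ^ 4)) := by
  obtain ⟨g, hg, hle⟩ := hF.exists_bound_rescaledIntegrand
  have hlim : ∫ w, rescaledIntegrand F (α * 0) (β * 0) w = ∫ z, |F z| ^ 4 := by
    have hsplit : rescaledIntegrand F (α * 0) (β * 0) =
        fun w => |F w.1| ^ 4 * (gaussCorr 1 w.2.1 * gaussCorr 1 w.2.2) := by
      ext w
      rw [(by decide : Even 4).pow_abs]
      simp only [rescaledIntegrand, mul_zero, zero_smul, sub_zero, Prod.mk.eta]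
      ring
    rw [hsplit]
    refine (integral_prod_mul (fun z => |F z| ^ 4)
      fun r : (Fin d → ℝ) × (Fin d → ℝ) => gaussCorr 1 r.1 * gaussCorr 1 r.2).trans ?_
    rw [show ∫ r : (Fin d → ℝ) × (Fin d → ℝ), gaussCorr 1 r.1 * gaussCorr 1 r.2 = 1 from
      (integral_prod_mul _ _).trans (by simp [integral_gaussCorr_one]), mul_one]
  rw [← hlim]
  have htends : Tendsto (fun t => ∫ w, rescaledIntegrand F (α * t) (β * t) w) (𝓝[>] 0)
      (𝓝 (∫ w, rescaledIntegrand F (α * 0) (β * 0) w)) := by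
    refine tendsto_integral_filter_of_dominated_convergence g
      (.of_forall fun t => (hF.continuous_rescaledIntegrand _ _).aestronglyMeasurable)
      (.of_forall fun t => ae_of_all _ fun w => hle _ _ w) hg (ae_of_all _ fun w => ?_)
    have hcont : Continuous fun t : ℝ => rescaledIntegrand F (α * t) (β * t) w := by
      have := hF.continuous
      unfold rescaledIntegrand
      fun_prop
    exact hcont.continuousWithinAt
  refine htends.congr' ?_
  filter_upwards [self_mem_nhdsWithin] with t ht
  exact (hF.corrForm_eq_integral_rescaledIntegrand (mul_pos hα ht) (mul_pos hβ ht)).symm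

theorem Theta_dil_dil_eq (hF : IsTame F) {ψ φ : (Fin d → ℝ) → ℝ} (hψ : IsTame ψ)
    (hφ : IsTame φ) {k l : ℝ → (Fin d → ℝ) → ℝ} {α β : ℝ} (hα : 0 < α) (hβ : 0 < β)
    (hk : ∀ s, 0 < s → ∀ x y, autocorr (dil s ψ) x y = k s (x - y))
    (hl : ∀ s, 0 < s → ∀ x y, autocorr (dil s φ) x y = l s (x - y)) :
    Theta (dil α ψ) (dil β φ) F = ∫ t in Ioi 0, corrForm F (k (α * t)) (l (β * t)) / t := by
  refine setIntegral_congr_fun measurableSet_Ioi fun t ht => ?_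
  have hαt : 0 < α * t := mul_pos hα ht
  have hβt : 0 < β * t := mul_pos hβ ht
  simp only [dil_dil, hF.iterated_form_eq (hψ.dil hαt) (hφ.dil hβt), hk _ hαt, hl _ hβt,
    corrForm]

theorem IsTame.corrForm_gaussDerivCorr_left_nonneg (hF : IsTame F) (i : Fin d) {a b : ℝ}
    (ha : 0 < a) (hb : 0 < b) : 0 ≤ corrForm F (gaussDerivCorr i a) (gaussCorr b) := by
  have h := hF.integral_quadProd_mul_autocorr_nonneg_left ((isTame_gaussDeriv i).dil ha)
    (isTame_gauss.dil hb) fun x y =>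
      (gaussCorr_nonneg hb _).trans_eq (autocorr_dil_gauss hb x y).symm
  simpa only [autocorr_dil_gauss hb, autocorr_dil_gaussDeriv i ha, corrForm] using h

theorem IsTame.corrForm_gaussDerivCorr_right_nonneg (hF : IsTame F) (i : Fin d) {a b : ℝ}
    (ha : 0 < a) (hb : 0 < b) : 0 ≤ corrForm F (gaussCorr a) (gaussDerivCorr i b) := by
  have h := hF.integral_quadProd_mul_autocorr_nonneg_right (isTame_gauss.dil ha)
    ((isTame_gaussDeriv i).dil hb) fun x y =>
      (gaussCorr_nonneg ha _).trans_eq (autocorr_dil_gauss ha x y).symm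
  simpa only [autocorr_dil_gauss ha, autocorr_dil_gaussDeriv i hb, corrForm] using h

theorem IsTame.measurable_corrForm (hF : IsTame F) {k l : ℝ → (Fin d → ℝ) → ℝ}
    (hk : Measurable fun z : ℝ × (Fin d → ℝ) => k z.1 z.2)
    (hl : Measurable fun z : ℝ × (Fin d → ℝ) => l z.1 z.2) (α β : ℝ) :
    Measurable fun t => corrForm F (k (α * t)) (l (β * t)) := by
  have hq := hF.continuous_quadProd.measurable
  have hk' := hk.comp (f := fun z : ℝ × (((Fin d → ℝ) × (Fin d → ℝ)) ×
    ((Fin d → ℝ) × (Fin d → ℝ))) => (α * z.1, z.2.1.1 - z.2.1.2)) (by fun_prop)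
  have hl' := hl.comp (f := fun z : ℝ × (((Fin d → ℝ) × (Fin d → ℝ)) ×
    ((Fin d → ℝ) × (Fin d → ℝ))) => (β * z.1, z.2.2.1 - z.2.2.2)) (by fun_prop)
  have hjoint := (hq.comp measurable_snd).mul (hk'.mul hl')
  exact hjoint.stronglyMeasurable.integral_prod_right.measurable

end Flow


theorem SchwartzMap.isTame {d : ℕ} (F : SchwartzMap ((Fin d → ℝ) × (Fin d → ℝ)) ℝ) :
    IsTame fun z => F z where
  continuous := F.continuous
  bounded := ⟨SchwartzMap.seminorm ℝ 0 0 F, fun z => F.norm_le_seminorm ℝ z⟩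
  integrable := by
    have : (volume : Measure ((Fin d → ℝ) × (Fin d → ℝ))).IsAddHaarMeasure :=
      Measure.prod.instIsAddHaarMeasure _ _
    exact F.integrable

section Identity

open Filter Topology Set

variable {d : ℕ} {F : (Fin d → ℝ) × (Fin d → ℝ) → ℝ}

/-- The integrated form of the monotonicity formula for the Gaussian flow. -/
theorem IsTame.integral_sum_corrForm (hF : IsTame F) (hd : 1 ≤ d) {α β : ℝ} (hα : 0 < α)
    (hβ : 0 < β) :
    IntegrableOn (fun t => (∑ i, (corrForm F (gaussDerivCorr i (α * t)) (gaussCorr (β * t)) +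
        corrForm F (gaussCorr (α * t)) (gaussDerivCorr i (β * t)))) / t) (Ioi 0) ∧
      ∫ t in Ioi 0, (∑ i, (corrForm F (gaussDerivCorr i (α * t)) (gaussCorr (β * t)) +
        corrForm F (gaussCorr (α * t)) (gaussDerivCorr i (β * t)))) / t =
      Real.pi * ∫ z, |F z| ^ 4 := by
  set U : ℝ → ℝ := fun t => ∑ i, (corrForm F (gaussDerivCorr i (α * t)) (gaussCorr (β * t)) +
    corrForm F (gaussCorr (α * t)) (gaussDerivCorr i (β * t))) with hU
  set J : ℝ → ℝ := fun t => corrForm F (gaussCorr (α * t)) (gaussCorr (β * t)) with hJ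
  have hcont : ContinuousWithinAt (Function.update J 0 (∫ z, |F z| ^ 4)) (Ici 0) 0 := by
    rw [continuousWithinAt_update_same, Ici_sdiff_left]
    exact hF.tendsto_corrForm_zero hα hβ
  have hderiv : ∀ t ∈ Ioi (0 : ℝ), HasDerivAt (Function.update J 0 (∫ z, |F z| ^ 4))
      (-(Real.pi * t)⁻¹ * U t) t := fun t ht =>
    (hF.hasDerivAt_corrForm hα hβ ht).congr_of_eventuallyEq <| by
      filter_upwards [lt_mem_nhds ht] with s hs
      exact Function.update_of_ne hs.ne' _ _
  have hnonpos : ∀ t ∈ Ioi (0 : ℝ), -(Real.pi * t)⁻¹ * U t ≤ 0 := fun t ht => by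
    have ht' : 0 < t := ht
    refine mul_nonpos_of_nonpos_of_nonneg (by simp only [neg_nonpos]; positivity)
      (Finset.sum_nonneg fun i _ => add_nonneg ?_ ?_)
    · exact hF.corrForm_gaussDerivCorr_left_nonneg i (mul_pos hα ht) (mul_pos hβ ht)
    · exact hF.corrForm_gaussDerivCorr_right_nonneg i (mul_pos hα ht) (mul_pos hβ ht)
  have hlim : Tendsto (Function.update J 0 (∫ z, |F z| ^ 4)) atTop (𝓝 0) := by
    refine (hF.tendsto_corrForm_atTop hd hα hβ).congr' ?_
    filter_upwards [eventually_gt_atTop 0] with t ht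
    exact (Function.update_of_ne ht.ne' _ J).symm
  have hint := integrableOn_Ioi_deriv_of_nonpos hcont hderiv hnonpos hlim
  have hval := integral_Ioi_of_hasDerivAt_of_nonpos hcont hderiv hnonpos hlim
  have hmul : (fun t => U t / t) = fun t => -Real.pi * (-(Real.pi * t)⁻¹ * U t) := by
    ext t
    field_simp
  rw [hmul]
  refine ⟨hint.const_mul _, ?_⟩
  rw [integral_const_mul, hval, Function.update_self]
  ring

theorem IsTame.integrableOn_corrForm_div (hF : IsTame F) (hd : 1 ≤ d) {α β : ℝ} (hα : 0 < α)
    (hβ : 0 < β) (i : Fin d) :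
    IntegrableOn (fun t => corrForm F (gaussDerivCorr i (α * t)) (gaussCorr (β * t)) / t)
        (Ioi 0) ∧
      IntegrableOn (fun t => corrForm F (gaussCorr (α * t)) (gaussDerivCorr i (β * t)) / t)
        (Ioi 0) := by
  have hsum := (hF.integral_sum_corrForm hd hα hβ).1
  have hK (j : Fin d) (t : ℝ) (ht : 0 < t) := hF.corrForm_gaussDerivCorr_left_nonneg j
    (mul_pos hα ht) (mul_pos hβ ht)
  have hL (j : Fin d) (t : ℝ) (ht : 0 < t) := hF.corrForm_gaussDerivCorr_right_nonneg j
    (mul_pos hα ht) (mul_pos hβ ht)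
  have hle (t : ℝ) (ht : 0 < t) := Finset.single_le_sum (s := Finset.univ)
    (fun j _ => add_nonneg (hK j t ht) (hL j t ht)) (Finset.mem_univ i)
  constructor
  · refine hsum.mono' ((hF.measurable_corrForm (measurable_gaussDerivCorr i)
      measurable_gaussCorr α β).div measurable_id).aestronglyMeasurable
      ((ae_restrict_iff' measurableSet_Ioi).2 (ae_of_all _ fun t ht => ?_))
    have ht' : 0 < t := ht
    rw [Real.norm_of_nonneg (div_nonneg (hK i t ht) ht'.le)]
    exact div_le_div_of_nonneg_right
      ((le_add_of_nonneg_right (hL i t ht)).trans (hle t ht)) ht'.le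
  · refine hsum.mono' ((hF.measurable_corrForm measurable_gaussCorr
      (measurable_gaussDerivCorr i) α β).div measurable_id).aestronglyMeasurable
      ((ae_restrict_iff' measurableSet_Ioi).2 (ae_of_all _ fun t ht => ?_))
    have ht' : 0 < t := ht
    rw [Real.norm_of_nonneg (div_nonneg (hL i t ht) ht'.le)]
    exact div_le_div_of_nonneg_right
      ((le_add_of_nonneg_left (hK i t ht)).trans (hle t ht)) ht'.le

end Identity

theorem sum_Theta_gaussians_identity (d : ℕ) (hd : 1 ≤ d)
    (F : SchwartzMap ((Fin d → ℝ) × (Fin d → ℝ)) ℝ) (α β : ℝ) (hα : 0 < α) (hβ : 0 < β) :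
    ∑ i : Fin d,
        (Theta (dil α (gaussDeriv d i)) (dil β (gauss d)) (fun z => F z) +
          Theta (dil α (gauss d)) (dil β (gaussDeriv d i)) (fun z => F z)) =
      Real.pi * ∫ z : (Fin d → ℝ) × (Fin d → ℝ), |F z| ^ 4 := by
  have hF := F.isTame
  have hint := hF.integrableOn_corrForm_div hd hα hβ
  rw [← (hF.integral_sum_corrForm hd hα hβ).2]
  simp only [Finset.sum_div, add_div]
  rw [integral_finsetSum _ (f := fun i t => _ + _) fun i _ =>
    (hint i).1.integrable.add (hint i).2.integrable]
  refine Finset.sum_congr rfl fun i _ => ?_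
  rw [integral_add (hint i).1 (hint i).2,
    Theta_dil_dil_eq hF (isTame_gaussDeriv i) isTame_gauss hα hβ
      (fun s hs => autocorr_dil_gaussDeriv i hs) (fun s hs => autocorr_dil_gauss hs),
    Theta_dil_dil_eq hF isTame_gauss (isTame_gaussDeriv i) hα hβ
      (fun s hs => autocorr_dil_gauss hs) (fun s hs => autocorr_dil_gaussDeriv i hs)]
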